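/- arXiv:2505.09332 — 4 statements merged into one kernel-verified Lean document; each statement's English description precedes it below -/
import Mathlib

section
/- For every natural number n, the presented group on two generators x, y with the two relators x^2 and (y*x⁻¹)^n * y * (x*y⁻¹)^n * x is isomorphic to the dihedral group of order 2(2n+1) (Mathlib's DihedralGroup (2n+1)). (This is the group-theoretic content of Theorem 3.4: the fundamental group of the Price twist τ_{S(T_{2,2n+1})} is the dihedral group D_{2n+1}.) -/
/-- The generator `x` of the free group on two generators. -/
def x : FreeGroup (Fin 2) := FreeGroup.of 0

/-- The generator `y` of the free group on two generators. -/
def y : FreeGroup (Fin 2) := FreeGroup.of 1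

/-- The relators `x²` and `(yx⁻¹)ⁿ y (xy⁻¹)ⁿ x` of the presentation of
`π₁(τ_{S(T_{2,2n+1})})` read off from its handle diagram. -/
def priceRels (n : ℕ) : Set (FreeGroup (Fin 2)) :=
  {x ^ 2, (y * x⁻¹) ^ n * y * (x * y⁻¹) ^ n * x}

/-- An element of `G` killed by `m` defines a homomorphism from the rotations of the `m`-gon. -/
def rotationLift {G : Type*} [Group G] {m : ℕ} {a : G} (ha : a ^ m = 1) :
    ZMod m →+ Additive G :=
  ZMod.lift m ⟨zmultiplesHom (Additive G) (Additive.ofMul a), by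
    simpa using congrArg Additive.ofMul ha⟩

theorem toMul_rotationLift_intCast {G : Type*} [Group G] {m : ℕ} {a : G} (ha : a ^ m = 1)
    (k : ℤ) : (rotationLift ha k).toMul = a ^ k := by
  simp [rotationLift]

theorem mul_toMul_rotationLift {G : Type*} [Group G] {m : ℕ} {a s : G} (ha : a ^ m = 1)
    (h : s * a * s⁻¹ = a⁻¹) (i : ZMod m) :
    (rotationLift ha i).toMul * s = s * (rotationLift ha (-i)).toMul := by
  obtain ⟨k, rfl⟩ := ZMod.intCast_surjective i
  rw [← Int.cast_neg, toMul_rotationLift_intCast, toMul_rotationLift_intCast,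
    eq_comm, ← mul_inv_eq_iff_eq_mul, ← conj_zpow, h, inv_zpow', neg_neg]

/-- The universal property of the dihedral group `⟨a, s ∣ aᵐ = s² = 1, s a s⁻¹ = a⁻¹⟩`. -/
def dihedralLift {G : Type*} [Group G] {m : ℕ} {a s : G} (ha : a ^ m = 1) (hs : s ^ 2 = 1)
    (h : s * a * s⁻¹ = a⁻¹) : DihedralGroup m →* G :=
  MonoidHom.mk'
    (fun
      | .r i => (rotationLift ha i).toMul
      | .sr i => s * (rotationLift ha i).toMul)
    (by
      have hc := mul_toMul_rotationLift ha h
      rintro (i | i) (j | j)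
      · simp
      · simp only [DihedralGroup.r_mul_sr, ← mul_assoc, hc]
        simp only [mul_assoc, ← toMul_add, ← map_add, neg_add_eq_sub]
      · simp [mul_assoc]
      · simp only [DihedralGroup.sr_mul_sr]
        rw [mul_assoc, ← mul_assoc _ s, hc, mul_assoc, ← mul_assoc s, ← sq, hs, one_mul,
          ← toMul_add, ← map_add, neg_add_eq_sub])

theorem dihedralLift_r_one {G : Type*} [Group G] {m : ℕ} {a s : G} (ha : a ^ m = 1)
    (hs : s ^ 2 = 1) (h : s * a * s⁻¹ = a⁻¹) : dihedralLift ha hs h (.r 1) = a := by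
  change (rotationLift ha 1).toMul = a
  simpa using toMul_rotationLift_intCast ha 1

theorem dihedralLift_sr_zero {G : Type*} [Group G] {m : ℕ} {a s : G} (ha : a ^ m = 1)
    (hs : s ^ 2 = 1) (h : s * a * s⁻¹ = a⁻¹) : dihedralLift ha hs h (.sr 0) = s := by
  simp [dihedralLift]

theorem dihedralGroup_hom_ext {G : Type*} [Group G] {m : ℕ} {f g : DihedralGroup m →* G}
    (hr : f (.r 1) = g (.r 1)) (hs : f (.sr 0) = g (.sr 0)) : f = g := by
  have hrot (i : ZMod m) : f (.r i) = g (.r i) := by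
    obtain ⟨k, rfl⟩ := ZMod.intCast_surjective i
    rw [← DihedralGroup.r_one_zpow, map_zpow, map_zpow, hr]
  ext (i | i)
  · exact hrot i
  · rw [← zero_add i, ← DihedralGroup.sr_mul_r, map_mul, map_mul, hs, hrot]

/-- The relators of `priceRels n`, in terms of the involution `s = x` and `a = y * x⁻¹`, force
conjugation by `s` to invert `a`. -/
theorem conj_eq_inv_of_price_relation {G : Type*} [Group G] {n : ℕ} {a s : G} (hs : s ^ 2 = 1)
    (h : a ^ n * (a * s) * a⁻¹ ^ n * s = 1) : s * a * s⁻¹ = a⁻¹ := by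
  have hinv : s⁻¹ = s := inv_eq_of_mul_eq_one_left (by rw [← sq, hs])
  have h₁ : s * a ^ n * s⁻¹ = a ^ (n + 1) := by
    rw [eq_comm, ← mul_inv_eq_one, pow_succ, mul_inv_rev, mul_inv_rev, inv_inv, hinv, ← inv_pow]
    simpa only [mul_assoc] using h
  have h₂ : s * a ^ (n + 1) * s⁻¹ = a ^ n := by
    rw [← h₁]
    simp only [hinv, mul_assoc]
    rw [← sq, hs, ← mul_assoc, ← sq, hs, one_mul, mul_one]
  have h₃ : s * a ^ (n + 1) * s⁻¹ = s * a ^ n * s⁻¹ * (s * a * s⁻¹) := by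
    rw [pow_succ]
    group
  rw [h₁, h₂, pow_succ, mul_assoc, left_eq_mul] at h₃
  exact (inv_eq_of_mul_eq_one_right h₃).symm

theorem pow_eq_one_of_price_relation {G : Type*} [Group G] {n : ℕ} {a s : G} (hs : s ^ 2 = 1)
    (h : a ^ n * (a * s) * a⁻¹ ^ n * s = 1) : a ^ (2 * n + 1) = 1 := by
  have hinv : s⁻¹ = s := inv_eq_of_mul_eq_one_left (by rw [← sq, hs])
  have hconj : s * a⁻¹ ^ n * s⁻¹ = a ^ n := by
    rw [← conj_pow, ← conj_inv, conj_eq_inv_of_price_relation hs h, inv_inv]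
  rw [hinv] at hconj
  calc a ^ (2 * n + 1) = a ^ n * a * a ^ n := by rw [← pow_succ, ← pow_add]; congr 1; ring
    _ = a ^ n * (a * s) * a⁻¹ ^ n * s := by rw [← hconj]; simp only [mul_assoc]
    _ = 1 := h

/-- The fundamental group `⟨x, y ∣ x² = 1, (yx⁻¹)ⁿ y (xy⁻¹)ⁿ x = 1⟩` of the Price twist
`τ_{S(T_{2,2n+1})}` is isomorphic to the dihedral group `D_{2n+1}`. -/
theorem stmt_0 (n : ℕ) :
    Nonempty (PresentedGroup (priceRels n) ≃* DihedralGroup (2 * n + 1)) := by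
  have hx : (PresentedGroup.of 0 : PresentedGroup (priceRels n)) ^ 2 = 1 :=
    PresentedGroup.one_of_mem (rels := priceRels n) (Set.mem_insert _ _)
  have hxy : ((PresentedGroup.of 1 * (PresentedGroup.of 0)⁻¹) ^ n * PresentedGroup.of 1 *
      (PresentedGroup.of 0 * (PresentedGroup.of 1)⁻¹) ^ n * PresentedGroup.of 0 :
        PresentedGroup (priceRels n)) = 1 :=
    PresentedGroup.one_of_mem (rels := priceRels n) (Set.mem_insert_of_mem _ rfl)
  set s : PresentedGroup (priceRels n) := PresentedGroup.of 0 with hs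
  set t : PresentedGroup (priceRels n) := PresentedGroup.of 1 with ht
  have hrel : (t * s⁻¹) ^ n * (t * s⁻¹ * s) * (t * s⁻¹)⁻¹ ^ n * s = 1 := by
    simpa using hxy
  have hlift : ∀ w ∈ priceRels n, FreeGroup.lift
      (![.sr 0, .sr (-1)] : Fin 2 → DihedralGroup (2 * n + 1)) w = 1 := by
    rintro w (rfl | rfl)
    · simp [x, sq]
    · have hn : (2 * n + 1 : ZMod (2 * n + 1)) = 0 := by
        exact_mod_cast ZMod.natCast_self (2 * n + 1)
      simp only [x, y, map_mul, map_pow, map_inv, FreeGroup.lift_apply_of, Matrix.cons_val_zero,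
        Matrix.cons_val_one, DihedralGroup.inv_sr, DihedralGroup.sr_mul_sr, DihedralGroup.r_pow,
        DihedralGroup.r_mul_sr, DihedralGroup.sr_mul_r, DihedralGroup.one_def]
      congr 1
      linear_combination hn
  let f := PresentedGroup.toGroup hlift
  let g := dihedralLift (pow_eq_one_of_price_relation hx hrel) hx
    (conj_eq_inv_of_price_relation hx hrel)
  have hfs : f s = .sr 0 := PresentedGroup.toGroup.of hlift
  have hft : f t = .sr (-1) := PresentedGroup.toGroup.of hlift
  have hgr : g (.r 1) = t * s⁻¹ := dihedralLift_r_one _ _ _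
  have hgs : g (.sr 0) = s := dihedralLift_sr_zero _ _ _
  refine ⟨MonoidHom.toMulEquiv f g (PresentedGroup.ext fun i ↦ ?_) (dihedralGroup_hom_ext ?_ ?_)⟩
  · fin_cases i
    · change g (f s) = s
      rw [hfs, hgs]
    · change g (f t) = t
      have hsr : (.sr (-1) : DihedralGroup (2 * n + 1)) = .r 1 * .sr 0 := by simp
      rw [hft, hsr, map_mul, hgr, hgs, inv_mul_cancel_right]
  · simp [hgr, hft, hfs]
  · simp [hgs, hfs]
end

section
/- For every natural number n, the presented group on two generators x₁, x₂ with the two relators x₁^2 and x₁ * (x₂*x₁)^n * x₂ * ((x₂*x₁)^n)⁻¹ is isomorphic to the dihedral group of order 2(2n+1) (Mathlib's DihedralGroup (2n+1)). (This is the τ-presentation of π₁(τ_{S(T_{2,2n+1})}).) -/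
/-- The generator `x₁` of the free group on two generators. -/
def x1 : FreeGroup (Fin 2) := FreeGroup.of 0

/-- The generator `x₂` of the free group on two generators. -/
def x2 : FreeGroup (Fin 2) := FreeGroup.of 1

/-- The relators `x₁²` and `x₁ (x₂x₁)ⁿ x₂ ((x₂x₁)ⁿ)⁻¹` of the τ-presentation of
`π₁(τ_{S(T_{2,2n+1})})`. -/
def tauRels (n : ℕ) : Set (FreeGroup (Fin 2)) :=
  {x1 ^ 2, x1 * (x2 * x1) ^ n * x2 * ((x2 * x1) ^ n)⁻¹}

namespace DihedralGroup

variable {G : Type*} [Group G] {m : ℕ}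

/-- The homomorphism `ZMod m → G` sending `1` to an element `a` with `a ^ m = 1`. -/
def zmodPow (a : G) (ha : a ^ m = 1) : ZMod m →+ Additive G :=
  ZMod.lift m ⟨zmultiplesHom (Additive G) (Additive.ofMul a), by
    rw [zmultiplesHom_apply, natCast_zsmul, ← ofMul_pow, ha, ofMul_one]⟩

theorem toMul_zmodPow_intCast (a : G) (ha : a ^ m = 1) (k : ℤ) :
    (zmodPow a ha (k : ZMod m)).toMul = a ^ k := by
  rw [zmodPow, ZMod.lift_coe]
  rfl

/-- The homomorphism from the dihedral group determined by a rotation `a` and a reflection `b`. -/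
def liftHom (a b : G) (ha : a ^ m = 1) (hb : b * b = 1) (hab : b * a * b⁻¹ = a⁻¹) :
    DihedralGroup m →* G :=
  MonoidHom.mk'
    (fun g => match g with
      | r i => (zmodPow a ha i).toMul
      | sr i => b * (zmodPow a ha i).toMul)
    (by
      have hswap (k : ℤ) : a ^ k * b = b * a ^ (-k) := by
        have hconj : b * a ^ (-k) * b⁻¹ = a ^ k := by
          rw [← conj_zpow, hab, inv_zpow', neg_neg]
        rw [← hconj, inv_mul_cancel_right]
      rintro (i | i) (j | j) <;>
        obtain ⟨k, rfl⟩ := ZMod.intCast_surjective i <;>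
        obtain ⟨l, rfl⟩ := ZMod.intCast_surjective j <;>
        simp only [r_mul_r, r_mul_sr, sr_mul_r, sr_mul_sr, ← Int.cast_add, ← Int.cast_sub,
          toMul_zmodPow_intCast]
      · rw [zpow_add]
      · rw [← mul_assoc, hswap, mul_assoc, ← zpow_add, neg_add_eq_sub]
      · rw [zpow_add, mul_assoc]
      · rw [mul_assoc, ← mul_assoc (a ^ k), hswap, mul_assoc, ← zpow_add, ← mul_assoc, hb,
          one_mul, neg_add_eq_sub])

theorem liftHom_r_intCast (a b : G) (ha : a ^ m = 1) (hb : b * b = 1)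
    (hab : b * a * b⁻¹ = a⁻¹) (k : ℤ) : liftHom a b ha hb hab (r k) = a ^ k :=
  toMul_zmodPow_intCast a ha k

theorem liftHom_sr_intCast (a b : G) (ha : a ^ m = 1) (hb : b * b = 1)
    (hab : b * a * b⁻¹ = a⁻¹) (k : ℤ) : liftHom a b ha hb hab (sr k) = b * a ^ k :=
  congrArg (b * ·) (toMul_zmodPow_intCast a ha k)

theorem hom_ext {f g : DihedralGroup m →* G} (hr : f (r 1) = g (r 1))
    (hs : f (sr 0) = g (sr 0)) : f = g := by
  have hrot (i : ZMod m) : f (r i) = g (r i) := by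
    obtain ⟨k, rfl⟩ := ZMod.intCast_surjective i
    rw [← r_one_zpow, map_zpow, map_zpow, hr]
  ext (i | i)
  · exact hrot i
  · rw [← zero_add i, ← sr_mul_r, map_mul, map_mul, hs, hrot]

end DihedralGroup

section

variable {G : Type*} [Group G] {c x : G} {n : ℕ}

theorem conj_eq_inv_of_conj_pow_succ (hx : x * x = 1) (h : x * c ^ (n + 1) * x⁻¹ = c ^ n) :
    x * c * x⁻¹ = c⁻¹ := by
  have hinv : x⁻¹ = x := inv_eq_of_mul_eq_one_left hx
  have h' : x * c ^ n * x⁻¹ = c ^ (n + 1) := by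
    rw [← h, hinv]
    simp only [mul_assoc, hx, mul_one]
    rw [← mul_assoc, hx, one_mul]
  calc x * c * x⁻¹ = x * c ^ (n + 1) * x⁻¹ * (x * c ^ n * x⁻¹)⁻¹ := by
        rw [pow_succ']; group
    _ = c⁻¹ := by rw [h, h', pow_succ]; group

theorem pow_eq_one_of_conj_pow_succ (hx : x * x = 1) (h : x * c ^ (n + 1) * x⁻¹ = c ^ n) :
    c ^ (2 * n + 1) = 1 := by
  have hpow : (c ^ (n + 1))⁻¹ = c ^ n := by
    rw [← inv_pow, ← conj_eq_inv_of_conj_pow_succ hx h, conj_pow, h]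
  rw [show 2 * n + 1 = n + (n + 1) by ring, pow_add, ← hpow, inv_mul_cancel]

end

/-- The images of `x₁` and `x₂` in the dihedral group. -/
def tauGen (n : ℕ) : Fin 2 → DihedralGroup (2 * n + 1) :=
  ![DihedralGroup.sr 0, DihedralGroup.sr (-1)]

theorem lift_tauGen_eq_one (n : ℕ) :
    ∀ w ∈ tauRels n, FreeGroup.lift (tauGen n) w = 1 := by
  have hn : (n : ZMod (2 * n + 1)) + n + 1 = 0 := by
    have h := ZMod.natCast_self (2 * n + 1)
    push_cast at h
    rw [← h]
    ring
  rintro w (rfl | rfl)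
  · simp [x1, tauGen, pow_two]
  · simp only [x1, x2, tauGen, map_mul, map_pow, map_inv, FreeGroup.lift_apply_of,
      Matrix.cons_val_zero, Matrix.cons_val_one, DihedralGroup.sr_mul_sr, DihedralGroup.r_pow,
      DihedralGroup.sr_mul_r, DihedralGroup.inv_r, DihedralGroup.r_mul_r, DihedralGroup.one_def]
    congr 1
    linear_combination -hn

theorem tau_x1_mul_self (n : ℕ) :
    PresentedGroup.mk (tauRels n) x1 * PresentedGroup.mk (tauRels n) x1 = 1 := by
  rw [← map_mul, ← pow_two]
  exact PresentedGroup.one_of_mem (Or.inl rfl)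

theorem tau_conj_pow_succ (n : ℕ) :
    PresentedGroup.mk (tauRels n) x1 * PresentedGroup.mk (tauRels n) (x2 * x1) ^ (n + 1) *
      (PresentedGroup.mk (tauRels n) x1)⁻¹ = PresentedGroup.mk (tauRels n) (x2 * x1) ^ n := by
  have h : PresentedGroup.mk (tauRels n) (x1 * (x2 * x1) ^ n * x2 * ((x2 * x1) ^ n)⁻¹) = 1 :=
    PresentedGroup.one_of_mem (Or.inr rfl)
  rw [map_mul, map_inv, mul_inv_eq_one] at h
  rw [← map_pow, ← map_pow, ← h, ← map_inv, ← map_mul, ← map_mul, pow_succ]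
  congr 1
  group

/-- The τ-presentation `⟨x₁, x₂ ∣ x₁² = 1, x₁ (x₂x₁)ⁿ x₂ ((x₂x₁)ⁿ)⁻¹ = 1⟩` of
`π₁(τ_{S(T_{2,2n+1})})` is isomorphic to the dihedral group `D_{2n+1}`. -/
theorem stmt_1 (n : ℕ) :
    Nonempty (PresentedGroup (tauRels n) ≃* DihedralGroup (2 * n + 1)) := by
  let x := PresentedGroup.mk (tauRels n) x1
  let c := PresentedGroup.mk (tauRels n) (x2 * x1)
  have hx : x * x = 1 := tau_x1_mul_self n
  have h : x * c ^ (n + 1) * x⁻¹ = c ^ n := tau_conj_pow_succ n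
  let φ := PresentedGroup.toGroup (lift_tauGen_eq_one n)
  let ψ := DihedralGroup.liftHom c x (pow_eq_one_of_conj_pow_succ hx h) hx
    (conj_eq_inv_of_conj_pow_succ hx h)
  have hφ0 : φ x = DihedralGroup.sr 0 := PresentedGroup.toGroup.of _
  have hφ1 : φ (PresentedGroup.mk (tauRels n) x2) = DihedralGroup.sr (-1) :=
    PresentedGroup.toGroup.of _
  have hφc : φ c = DihedralGroup.r 1 := by
    rw [show c = PresentedGroup.mk (tauRels n) x2 * x from map_mul _ _ _, map_mul, hφ0, hφ1,
      DihedralGroup.sr_mul_sr, sub_neg_eq_add, zero_add]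
  have hψr (k : ℤ) : ψ (DihedralGroup.r k) = c ^ k := DihedralGroup.liftHom_r_intCast ..
  have hψs (k : ℤ) : ψ (DihedralGroup.sr k) = x * c ^ k := DihedralGroup.liftHom_sr_intCast ..
  have hψr1 : ψ (DihedralGroup.r 1) = c := by simpa using hψr 1
  have hψs0 : ψ (DihedralGroup.sr 0) = x := by simpa using hψs 0
  refine ⟨φ.toMulEquiv ψ (PresentedGroup.ext fun i => ?_) (DihedralGroup.hom_ext ?_ ?_)⟩
  · fin_cases i
    · change ψ (φ x) = x
      rw [hφ0, hψs0]
    · change ψ (φ (PresentedGroup.mk (tauRels n) x2)) = PresentedGroup.mk (tauRels n) x2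
      have hx2 : PresentedGroup.mk (tauRels n) x2 = c * x⁻¹ := by
        rw [← map_inv, ← map_mul, mul_inv_cancel_right]
      rw [hx2, map_mul, map_inv, hφc, hφ0, map_mul, map_inv, hψr1, hψs0]
  · rw [MonoidHom.comp_apply, MonoidHom.id_apply, hψr1, hφc]
  · rw [MonoidHom.comp_apply, MonoidHom.id_apply, hψs0, hφ0]
end

section
/- For every natural number n, the presented group on two generators a, b with the two relators (b^n * a)^2 and a^2 * b^(2n+1) is isomorphic to the dihedral group of order 2(2n+1) (Mathlib's DihedralGroup (2n+1)). -/
/-- The generator `a` of the free group on two generators. -/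
def a : FreeGroup (Fin 2) := FreeGroup.of 0

/-- The generator `b` of the free group on two generators. -/
def b : FreeGroup (Fin 2) := FreeGroup.of 1

/-- The relators `(bⁿa)²` and `a² b^(2n+1)` arising in the proof of Theorem 3.4. -/
def abRels (n : ℕ) : Set (FreeGroup (Fin 2)) :=
  {(b ^ n * a) ^ 2, a ^ 2 * b ^ (2 * n + 1)}

theorem zpow_intCast_zmod_cast {G : Type*} [Group G] {m : ℕ} {g : G} (hg : g ^ m = 1) (k : ℤ) :
    g ^ ((k : ZMod m).cast : ℤ) = g ^ k := by
  have h : (((k : ZMod m).cast : ℤ) : ZMod m) = (k : ZMod m) := ZMod.intCast_zmod_cast _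
  obtain ⟨c, hc⟩ := (ZMod.intCast_eq_intCast_iff_dvd_sub _ _ _).1 h.symm
  rw [sub_eq_iff_eq_add] at hc
  rw [hc, zpow_add, zpow_mul, zpow_natCast, hg, one_zpow, one_mul]

theorem conj_zpow_eq_zpow_neg {G : Type*} [Group G] {ρ σ : G} (h : σ * ρ * σ⁻¹ = ρ⁻¹) (k : ℤ) :
    ρ ^ k * σ = σ * ρ ^ (-k) := by
  have h' : σ * ρ ^ (-k) * σ⁻¹ = ρ ^ k := by
    rw [← conj_zpow, h, inv_zpow, zpow_neg, inv_inv]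
  rw [← h', inv_mul_cancel_right]

/-- The homomorphism from the dihedral group determined by a rotation `ρ` and a reflection `σ`. -/
def DihedralGroup.lift {G : Type*} [Group G] {m : ℕ} (ρ σ : G) (hρ : ρ ^ m = 1)
    (hσ : σ * σ = 1) (h : σ * ρ * σ⁻¹ = ρ⁻¹) : DihedralGroup m →* G :=
  MonoidHom.mk'
    (fun
      | .r i => ρ ^ (i.cast : ℤ)
      | .sr i => σ * ρ ^ (i.cast : ℤ))
    (by
      have hc := conj_zpow_eq_zpow_neg h
      rintro (i | i) (j | j) <;>
        obtain ⟨i, rfl⟩ := ZMod.intCast_surjective i <;>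
        obtain ⟨j, rfl⟩ := ZMod.intCast_surjective j <;>
        simp only [DihedralGroup.r_mul_r, DihedralGroup.r_mul_sr, DihedralGroup.sr_mul_r,
          DihedralGroup.sr_mul_sr, ← Int.cast_add, ← Int.cast_sub, zpow_intCast_zmod_cast hρ]
      · exact zpow_add ρ i j
      · rw [← mul_assoc, hc, mul_assoc, ← zpow_add, neg_add_eq_sub]
      · rw [mul_assoc, zpow_add]
      · rw [mul_assoc, ← mul_assoc (ρ ^ i), hc, mul_assoc, ← zpow_add, ← mul_assoc, hσ, one_mul,
          neg_add_eq_sub])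

theorem DihedralGroup.lift_r_intCast {G : Type*} [Group G] {m : ℕ} {ρ σ : G} (hρ : ρ ^ m = 1)
    (hσ : σ * σ = 1) (h : σ * ρ * σ⁻¹ = ρ⁻¹) (k : ℤ) :
    DihedralGroup.lift ρ σ hρ hσ h (.r k) = ρ ^ k :=
  zpow_intCast_zmod_cast hρ k

theorem DihedralGroup.lift_sr_intCast {G : Type*} [Group G] {m : ℕ} {ρ σ : G} (hρ : ρ ^ m = 1)
    (hσ : σ * σ = 1) (h : σ * ρ * σ⁻¹ = ρ⁻¹) (k : ℤ) :
    DihedralGroup.lift ρ σ hρ hσ h (.sr k) = σ * ρ ^ k :=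
  congrArg (σ * ·) (zpow_intCast_zmod_cast hρ k)

section Relations

variable {G : Type*} [Group G] {n : ℕ} {u v : G}

theorem conj_eq_inv_of_relations (h₁ : (v ^ n * u) ^ 2 = 1) (h₂ : u ^ 2 * v ^ (2 * n + 1) = 1) :
    (v ^ n * u) * v * (v ^ n * u)⁻¹ = v⁻¹ := by
  obtain ⟨σ, hσ⟩ : ∃ σ, σ = v ^ n * u := ⟨_, rfl⟩
  have hu : u = (v ^ n)⁻¹ * σ := by rw [hσ, inv_mul_cancel_left]
  have hinv : σ⁻¹ = σ := by
    rw [inv_eq_iff_mul_eq_one, ← pow_two, hσ, h₁]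
  have e₁ : σ * v ^ n * σ⁻¹ = v ^ (n + 1) := by
    rw [hu, pow_two] at h₂
    have h₃ : σ * (v ^ n)⁻¹ * σ = (v ^ (n + 1))⁻¹ := by
      rw [eq_inv_iff_mul_eq_one]
      have hv : v ^ (2 * n + 1) = v ^ (n + 1) * v ^ n := by rw [← pow_add]; congr 1; ring
      calc σ * (v ^ n)⁻¹ * σ * v ^ (n + 1)
          = v ^ n * ((v ^ n)⁻¹ * σ * ((v ^ n)⁻¹ * σ) * v ^ (2 * n + 1)) * (v ^ n)⁻¹ := by
            simp only [hv, mul_assoc, mul_inv_cancel_left, mul_inv_cancel, mul_one]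
        _ = 1 := by rw [h₂, mul_one, mul_inv_cancel]
    rw [← inv_inj, ← h₃, mul_inv_rev, mul_inv_rev, inv_inv, hinv, mul_assoc]
  have e₂ : σ * v ^ (n + 1) * σ⁻¹ = v ^ n := by
    rw [← e₁, hinv]
    have : σ * σ = 1 := by rw [← inv_eq_iff_mul_eq_one, hinv]
    rw [← mul_assoc, ← mul_assoc, this, one_mul, mul_assoc, this, mul_one]
  rw [← hσ]
  calc σ * v * σ⁻¹ = (σ * v ^ (n + 1) * σ⁻¹) * (σ * v ^ n * σ⁻¹)⁻¹ := by
        rw [pow_succ']; group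
    _ = v⁻¹ := by rw [e₁, e₂, pow_succ']; group

theorem pow_eq_one_of_relations (h₁ : (v ^ n * u) ^ 2 = 1)
    (h₂ : u ^ 2 * v ^ (2 * n + 1) = 1) : v ^ (2 * n + 1) = 1 := by
  have h := conj_zpow_eq_zpow_neg (conj_eq_inv_of_relations h₁ h₂) (-n)
  have hu : u * u = 1 := by
    have : u = (v ^ n * u) * v ^ n := by simpa using h
    calc u * u = (v ^ n * u * v ^ n) * u := by rw [← this]
      _ = 1 := by rw [mul_assoc, ← pow_two, h₁]
  rwa [pow_two, hu, one_mul] at h₂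

end Relations

/-- The presented group `⟨a, b ∣ (bⁿa)² = 1, a² b^(2n+1) = 1⟩` is isomorphic to the
dihedral group `D_{2n+1}`. -/
theorem stmt_2 (n : ℕ) :
    Nonempty (PresentedGroup (abRels n) ≃* DihedralGroup (2 * n + 1)) := by
  let u : PresentedGroup (abRels n) := .of 0
  let v : PresentedGroup (abRels n) := .of 1
  have h₁ : (v ^ n * u) ^ 2 = 1 :=
    PresentedGroup.one_of_mem (rels := abRels n) (x := (b ^ n * a) ^ 2) (by simp [abRels])
  have h₂ : u ^ 2 * v ^ (2 * n + 1) = 1 :=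
    PresentedGroup.one_of_mem (rels := abRels n) (x := a ^ 2 * b ^ (2 * n + 1))
      (by simp [abRels])
  have hconj := conj_eq_inv_of_relations h₁ h₂
  have hrels : ∀ w ∈ abRels n,
      FreeGroup.lift ![DihedralGroup.sr (n : ZMod (2 * n + 1)), .r 1] w = 1 := by
    rintro w (rfl | rfl) <;> simp [a, b, pow_two]
  let φ := PresentedGroup.toGroup hrels
  let ψ := DihedralGroup.lift (m := 2 * n + 1) v (v ^ n * u) (pow_eq_one_of_relations h₁ h₂)
    (by rw [← pow_two, h₁]) hconj
  have hφu : φ u = .sr n := PresentedGroup.toGroup.of hrels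
  have hφv : φ v = .r 1 := PresentedGroup.toGroup.of hrels
  have hψr (k : ℤ) : ψ (.r k) = v ^ k := DihedralGroup.lift_r_intCast _ _ _ k
  have hψsr (k : ℤ) : ψ (.sr k) = v ^ n * u * v ^ k := DihedralGroup.lift_sr_intCast _ _ _ k
  refine ⟨MonoidHom.toMulEquiv φ ψ (PresentedGroup.ext fun i => ?_) (MonoidHom.ext fun g => ?_)⟩
  · fin_cases i
    · change ψ (φ u) = u
      have := conj_zpow_eq_zpow_neg hconj (-n)
      rw [hφu, ← Int.cast_natCast n, hψsr]
      simpa using this.symm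
    · change ψ (φ v) = v
      rw [hφv, ← Int.cast_one, hψr, zpow_one]
  · change φ (ψ g) = g
    obtain k | k := g <;> obtain ⟨k, rfl⟩ := ZMod.intCast_surjective k
    · rw [hψr, map_zpow, hφv, DihedralGroup.r_one_zpow]
    · rw [hψsr]
      simp [hφu, hφv]
end

section
/- For every natural number n, in the free group on two generators a, b, the normal closure of the set {(b^n * a)^2, a^2 * b^(2n+1)} equals the normal closure of the set {a^2, (a*b)^2, b^(2n+1)}; consequently the two presented groups ⟨a, b | (b^n a)² = 1, a² b^(2n+1) = 1⟩ and ⟨a, b | a² = 1, (ab)² = 1, b^(2n+1) = 1⟩ are equal (in particular isomorphic). -/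
/-- The relators `(bⁿa)²` and `a² b^(2n+1)`. -/
def rels₁ (n : ℕ) : Set (FreeGroup (Fin 2)) :=
  {(b ^ n * a) ^ 2, a ^ 2 * b ^ (2 * n + 1)}

/-- The relators `a²`, `(ab)²` and `b^(2n+1)` of the dihedral group `D_{2n+1}`. -/
def rels₂ (n : ℕ) : Set (FreeGroup (Fin 2)) :=
  {a ^ 2, (a * b) ^ 2, b ^ (2 * n + 1)}

/-- In any group, the relations `(yⁿx)² = 1`, `x² y^(2n+1) = 1` hold if and only if the dihedral
relations `x² = 1`, `(xy)² = 1`, `y^(2n+1) = 1` hold. -/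
theorem relations_iff_dihedral_relations {G : Type*} [Group G] (x y : G) (n : ℕ) :
    ((y ^ n * x) ^ 2 = 1 ∧ x ^ 2 * y ^ (2 * n + 1) = 1) ↔
      (x ^ 2 = 1 ∧ (x * y) ^ 2 = 1 ∧ y ^ (2 * n + 1) = 1) := by
  have conj_eq_inv_of_pow : ∀ k : ℕ, x * y * x⁻¹ = y⁻¹ → x * y ^ k * x⁻¹ = (y ^ k)⁻¹ :=
    fun k h ↦ by rw [← conj_pow, h, inv_pow]
  constructor
  · rintro ⟨h₁, h₂⟩
    have hx : x ^ 2 = (y ^ (2 * n + 1))⁻¹ := eq_inv_of_mul_eq_one_left h₂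
    have hn : x * y ^ n * x⁻¹ = y ^ (n + 1) := by
      calc x * y ^ n * x⁻¹ = (y ^ n)⁻¹ * (y ^ n * x) ^ 2 * (x ^ 2)⁻¹ := by
            rw [sq (y ^ n * x)]; group
        _ = y ^ (n + 1) := by rw [h₁, hx]; group
    have hodd : x * y ^ (2 * n + 1) * x⁻¹ = y ^ (2 * n + 1) := by
      rw [← inv_inv (y ^ (2 * n + 1)), ← hx]; group
    have hconj : x * y * x⁻¹ = y⁻¹ := by
      calc x * y * x⁻¹
          = (x * y ^ n * x⁻¹)⁻¹ * (x * y ^ (2 * n + 1) * x⁻¹) * (x * y ^ n * x⁻¹)⁻¹ := by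
            group
        _ = y⁻¹ := by rw [hn, hodd]; group
    have hy : y ^ (2 * n + 1) = 1 := by
      calc y ^ (2 * n + 1) = y ^ n * y ^ (n + 1) := by rw [← pow_add]; congr 1; ring
        _ = 1 := by rw [← hn, conj_eq_inv_of_pow n hconj, mul_inv_cancel]
    have hx' : x ^ 2 = 1 := by rw [hx, hy, inv_one]
    refine ⟨hx', ?_, hy⟩
    calc (x * y) ^ 2 = (x * y * x⁻¹) * x ^ 2 * y := by rw [sq (x * y)]; group
      _ = 1 := by rw [hconj, hx']; group
  · rintro ⟨hx, hxy, hy⟩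
    have hconj : x * y * x⁻¹ = y⁻¹ := by
      calc x * y * x⁻¹ = (x * y) ^ 2 * y⁻¹ * (x ^ 2)⁻¹ := by rw [sq (x * y)]; group
        _ = y⁻¹ := by rw [hx, hxy]; group
    refine ⟨?_, by rw [hx, hy, one_mul]⟩
    calc (y ^ n * x) ^ 2 = y ^ n * (x * y ^ n * x⁻¹) * x ^ 2 := by
            rw [sq (y ^ n * x)]; group
      _ = 1 := by rw [conj_eq_inv_of_pow n hconj, hx]; group

/-- A normal subgroup contains `rels₁ n` if and only if it contains `rels₂ n`. -/
theorem rels₁_subset_iff_rels₂_subset (n : ℕ) (N : Subgroup (FreeGroup (Fin 2))) [N.Normal] :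
    rels₁ n ⊆ N ↔ rels₂ n ⊆ N := by
  simpa only [← QuotientGroup.eq_one_iff, QuotientGroup.mk_mul, QuotientGroup.mk_pow,
    rels₁, rels₂, Set.insert_subset_iff, Set.singleton_subset_iff, SetLike.mem_coe] using
    relations_iff_dihedral_relations (a : FreeGroup (Fin 2) ⧸ N) b n

theorem normalClosure_rels₁_eq_normalClosure_rels₂ (n : ℕ) :
    Subgroup.normalClosure (rels₁ n) = Subgroup.normalClosure (rels₂ n) :=
  le_antisymm
    (Subgroup.normalClosure_le_normal <|
      (rels₁_subset_iff_rels₂_subset n _).2 Subgroup.subset_normalClosure)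
    (Subgroup.normalClosure_le_normal <|
      (rels₁_subset_iff_rels₂_subset n _).1 Subgroup.subset_normalClosure)

/-- In the free group on `a, b`, the normal closure of `{(bⁿa)², a² b^(2n+1)}` equals the
normal closure of `{a², (ab)², b^(2n+1)}`; consequently the two presented groups
`⟨a, b ∣ (bⁿa)² = 1, a² b^(2n+1) = 1⟩` and `⟨a, b ∣ a² = 1, (ab)² = 1, b^(2n+1) = 1⟩`
are equal, and in particular isomorphic. -/
theorem stmt_3 (n : ℕ) :
    Subgroup.normalClosure (rels₁ n) = Subgroup.normalClosure (rels₂ n) ∧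
    PresentedGroup (rels₁ n) = PresentedGroup (rels₂ n) ∧
    Nonempty (PresentedGroup (rels₁ n) ≃* PresentedGroup (rels₂ n)) := by
  have h := normalClosure_rels₁_eq_normalClosure_rels₂ n
  exact ⟨h, by rw [PresentedGroup, PresentedGroup, h],
    ⟨QuotientGroup.quotientMulEquivOfEq h⟩⟩
end
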